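/- Let B be an 𝔽-graded C*-algebra with semi-saturated orthogonal grading and dynamics σ determined by a homomorphism N : 𝔽 → ℝ₊* with N(x) > 1 for all generators x. If ψ is a KMS_β state on B for β ∈ (0,∞), then ψ(B_g) = {0} for all g ≠ e. -/

import Mathlib

open scoped Pointwise

/-- Every word is positive-then-negative, or contains an adjacent pair `x⁻¹ y`. -/
theorem word_split {α : Type*} (L : List (α × Bool)) :
    (∃ P Q : List (α × Bool), L = P ++ Q ∧ (∀ a ∈ P, a.2 = true) ∧ (∀ a ∈ Q, a.2 = false)) ∨
    (∃ L1 x y L2, L = L1 ++ ((x, false) :: (y, true) :: L2)) := by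
  induction L with
  | nil => exact Or.inl ⟨[], [], by simp⟩
  | cons a L ih =>
    rcases ih with ⟨P, Q, rfl, hP, hQ⟩ | ⟨L1, x, y, L2, rfl⟩
    · obtain ⟨a, s⟩ := a
      cases s with
      | true =>
        refine Or.inl ⟨(a, true) :: P, Q, by simp, ?_, hQ⟩
        intro c hc
        rcases List.mem_cons.1 hc with rfl | hc
        · rfl
        · exact hP c hc
      | false =>
        cases P with
        | nil =>
          refine Or.inl ⟨[], (a, false) :: Q, by simp, by simp, ?_⟩
          intro c hc
          rcases List.mem_cons.1 hc with rfl | hc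
          · rfl
          · exact hQ c hc
        | cons p P =>
          obtain ⟨y, t⟩ := p
          have : t = true := hP (y, t) (by simp)
          subst this
          exact Or.inr ⟨[], a, y, P ++ Q, by simp⟩
    · exact Or.inr ⟨a :: L1, x, y, L2, by simp⟩

theorem const_reduced {α : Type*} (s : Bool) (L : List (α × Bool)) (h : ∀ a ∈ L, a.2 = s) :
    FreeGroup.IsReduced L := by
  unfold FreeGroup.IsReduced
  induction L with
  | nil => simp
  | cons a L ih =>
    rw [List.isChain_cons]
    refine ⟨?_, ih fun c hc => h c (by simp [hc])⟩
    intro b hb _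
    rw [h a (by simp), h b (by simp [List.mem_of_mem_head? hb])]

theorem N_pos_word {α : Type*} (N : FreeGroup α → ℝ) (hNpos : ∀ g, 0 < N g)
    (hNmul : ∀ g h, N (g * h) = N g * N h) (hNgen : ∀ x : α, 1 < N (FreeGroup.of x))
    (L : List (α × Bool)) (h : ∀ a ∈ L, a.2 = true) (hL : L ≠ []) : 1 < N (FreeGroup.mk L) := by
  have h1 : N 1 = 1 := by
    have := hNmul 1 1
    have h0 := hNpos 1
    rw [mul_one] at this
    nlinarith
  have key : ∀ L : List (α × Bool), (∀ a ∈ L, a.2 = true) → 1 ≤ N (FreeGroup.mk L) := by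
    intro L
    induction L with
    | nil => intro _; exact h1.ge
    | cons a L ih =>
      intro h
      obtain ⟨x, s⟩ := a
      have : s = true := h (x, s) (by simp)
      subst this
      have e : FreeGroup.mk ((x, true) :: L) = FreeGroup.of x * FreeGroup.mk L := by
        rw [FreeGroup.of, FreeGroup.mul_mk]; rfl
      rw [e, hNmul]
      have := ih fun c hc => h c (by simp [hc])
      nlinarith [hNgen x]
  cases L with
  | nil => exact absurd rfl hL
  | cons a L =>
    obtain ⟨x, s⟩ := a
    have : s = true := h (x, s) (by simp)
    subst this
    have e : FreeGroup.mk ((x, true) :: L) = FreeGroup.of x * FreeGroup.mk L := by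
      rw [FreeGroup.of, FreeGroup.mul_mk]; rfl
    rw [e, hNmul]
    have := key L fun c hc => h c (by simp [hc])
    nlinarith [hNgen x]

theorem N_neg_word {α : Type*} (N : FreeGroup α → ℝ) (hNpos : ∀ g, 0 < N g)
    (hNmul : ∀ g h, N (g * h) = N g * N h) (hNgen : ∀ x : α, 1 < N (FreeGroup.of x))
    (L : List (α × Bool)) (h : ∀ a ∈ L, a.2 = false) (hL : L ≠ []) : N (FreeGroup.mk L) < 1 := by
  have h1 : N 1 = 1 := by
    have := hNmul 1 1
    have h0 := hNpos 1
    rw [mul_one] at this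
    nlinarith
  have h2 : 1 < N (FreeGroup.mk L)⁻¹ := by
    rw [FreeGroup.inv_mk]
    apply N_pos_word N hNpos hNmul hNgen
    · intro a ha
      simp only [FreeGroup.invRev, List.mem_reverse, List.mem_map] at ha
      obtain ⟨b, hb, rfl⟩ := ha
      simp [h b hb]
    · intro h0
      apply hL
      have := congrArg List.length h0
      simpa using this
  have h3 := hNmul (FreeGroup.mk L) (FreeGroup.mk L)⁻¹
  rw [mul_inv_cancel, h1] at h3
  nlinarith [hNpos (FreeGroup.mk L)]

/-- Let `B` be a C*-algebra graded over the free group `𝔽` on generators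
`𝒢` by a semi-saturated orthogonal grading, with dynamics determined by a group
homomorphism `N : 𝔽 → ℝ₊*` satisfying `N(x) > 1` for all generators `x`.  If `ψ` is a
KMS state at inverse temperature `β ∈ (0,∞)` — i.e. `ψ(ab) = N(g)^β ψ(ba)` for all
`a ∈ B`, `b ∈ B_g` — then `ψ` vanishes on `B_g` for every `g ≠ e`.
(The fact `B_μ = closed span of B_e B_μ` for `μ ∈ 𝔽₊`, from [BMS: 1.7], is supplied
as a hypothesis.) -/
theorem stmt_7 {𝒢 : Type*} [DecidableEq 𝒢] {B : Type*} [NormedRing B] [StarRing B]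
    [CStarRing B] [NormedAlgebra ℂ B] [CompleteSpace B] [StarModule ℂ B]
    (Bg : FreeGroup 𝒢 → Submodule ℂ B)
    (hclosed : ∀ g, IsClosed (Bg g : Set B))
    (hmul : ∀ g h, ∀ a ∈ Bg g, ∀ b ∈ Bg h, a * b ∈ Bg (g * h))
    (hstar : ∀ g, ∀ a ∈ Bg g, star a ∈ Bg g⁻¹)
    (hindep : iSupIndep Bg)
    (hdense : (⨆ g, Bg g).topologicalClosure = ⊤)
    (hss : ∀ g h : FreeGroup 𝒢,
      (g * h).toWord.length = g.toWord.length + h.toWord.length →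
      Bg (g * h) = (Submodule.span ℂ ((Bg g : Set B) * (Bg h : Set B))).topologicalClosure)
    (horth : ∀ x y : 𝒢, x ≠ y →
      ∀ a ∈ Bg (FreeGroup.of x), ∀ b ∈ Bg (FreeGroup.of y), star a * b = 0)
    (hBe : ∀ μ ∈ Submonoid.closure (Set.range (FreeGroup.of : 𝒢 → FreeGroup 𝒢)),
      Bg μ = (Submodule.span ℂ ((Bg (1 : FreeGroup 𝒢) : Set B) * (Bg μ : Set B))).topologicalClosure)
    (N : FreeGroup 𝒢 → ℝ) (hNpos : ∀ g, 0 < N g)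
    (hNmul : ∀ g h, N (g * h) = N g * N h)
    (hNgen : ∀ x : 𝒢, 1 < N (FreeGroup.of x))
    (ψ : B →L[ℂ] ℂ) (hψ1 : ψ 1 = 1)
    (hψpos : ∀ b : B, 0 ≤ (ψ (star b * b)).re ∧ (ψ (star b * b)).im = 0)
    (β : ℝ) (hβ : 0 < β)
    (hKMS : ∀ (a : B) (g : FreeGroup 𝒢), ∀ b ∈ Bg g,
      ψ (a * b) = ((((N g) ^ β : ℝ)) : ℂ) * ψ (b * a)) :
    ∀ g : FreeGroup 𝒢, g ≠ 1 → ∀ b ∈ Bg g, ψ b = 0 := by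
  -- reduced concatenations
  have hcat : ∀ (K : Submodule ℂ B), IsClosed (K : Set B) → ∀ L1 L2 : List (𝒢 × Bool),
      FreeGroup.IsReduced (L1 ++ L2) →
      (∀ a ∈ Bg (FreeGroup.mk L1), ∀ b ∈ Bg (FreeGroup.mk L2), a * b ∈ K) →
      Bg (FreeGroup.mk (L1 ++ L2)) ≤ K := by
    intro K hK L1 L2 hr hab
    have r1 : FreeGroup.IsReduced L1 := (List.isChain_append.1 hr).1
    have r2 : FreeGroup.IsReduced L2 := (List.isChain_append.1 hr).2.1
    have hl := hss (FreeGroup.mk L1) (FreeGroup.mk L2) (by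
      rw [FreeGroup.mul_mk, FreeGroup.toWord_mk, FreeGroup.toWord_mk, FreeGroup.toWord_mk,
        hr.reduce_eq, r1.reduce_eq, r2.reduce_eq, List.length_append])
    rw [FreeGroup.mul_mk] at hl
    rw [hl]
    refine Submodule.topologicalClosure_minimal _ (Submodule.span_le.2 ?_) hK
    rintro _ ⟨a, ha, b, hb, rfl⟩
    exact hab a ha b hb
  have hbot : IsClosed ((⊥ : Submodule ℂ B) : Set B) := by
    simp
  have hker : IsClosed ((LinearMap.ker (ψ : B →ₗ[ℂ] ℂ) : Submodule ℂ B) : Set B) := ψ.isClosed_ker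
  -- words containing `x⁻¹ y`
  have hZ : ∀ (L1 : List (𝒢 × Bool)) (x y : 𝒢) (L2 : List (𝒢 × Bool)),
      FreeGroup.IsReduced (L1 ++ ((x, false) :: (y, true) :: L2)) →
      Bg (FreeGroup.mk (L1 ++ ((x, false) :: (y, true) :: L2))) ≤ ⊥ := by
    intro L1 x y L2 hr
    have r2 : FreeGroup.IsReduced ([(x, false), (y, true)] ++ L2) := (List.isChain_append.1 hr).2.1
    have r3 : FreeGroup.IsReduced ([(x, false)] ++ [(y, true)]) := (List.isChain_append.1 r2).1
    have hxy : x ≠ y := by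
      rintro rfl
      have := (List.isChain_cons_cons.1 r3).1 rfl
      simp at this
    have z3 := hcat ⊥ hbot _ _ r3 (by
      intro a ha b hb
      have ha' : star a ∈ Bg (FreeGroup.of x) := by
        have := hstar _ a ha
        rw [FreeGroup.inv_mk] at this
        exact this
      have := horth x y hxy _ ha' b hb
      rw [star_star] at this
      simp [this])
    have z2 := hcat ⊥ hbot _ _ r2 (by
      intro a ha b hb
      have : a = 0 := by simpa using z3 ha
      simp [this])
    refine hcat ⊥ hbot _ _ hr ?_
    intro a ha b hb
    have : b = 0 := by simpa using z2 hb
    simp [this]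
  -- `N g ≠ 1`
  have hN1 : ∀ g, N g ≠ 1 → ∀ b ∈ Bg g, ψ b = 0 := by
    intro g hg b hb
    have h := hKMS 1 g b hb
    rw [one_mul, mul_one] at h
    have hne : (((N g) ^ β : ℝ) : ℂ) ≠ 1 := by
      intro h1
      have h1 : (N g) ^ β = 1 := by exact_mod_cast h1
      rw [← Real.one_rpow β, Real.rpow_left_inj (hNpos g).le zero_le_one hβ.ne'] at h1
      exact hg h1
    by_contra hb0
    exact hne (mul_right_cancel₀ hb0 (by rw [one_mul]; exact h.symm))
  -- negative-then-positive words
  have hQP : ∀ (P Q : List (𝒢 × Bool)), (∀ a ∈ P, a.2 = true) → (∀ a ∈ Q, a.2 = false) →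
      FreeGroup.mk (Q ++ P) ≠ 1 → ∀ b ∈ Bg (FreeGroup.mk (Q ++ P)), ψ b = 0 := by
    intro P
    induction P with
    | nil =>
      intro Q _ hQ hne b hb
      rw [List.append_nil] at hne hb
      refine hN1 _ (N_neg_word N hNpos hNmul hNgen Q hQ ?_).ne b hb
      rintro rfl
      exact hne rfl
    | cons p P ih =>
      intro Q hP hQ hne b hb
      obtain ⟨y, t⟩ := p
      have : t = true := hP (y, t) (by simp)
      subst this
      rcases List.eq_nil_or_concat Q with rfl | ⟨Q', q, rfl⟩
      · exact hN1 _ (N_pos_word N hNpos hNmul hNgen _ hP (by simp)).ne' b hb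
      · obtain ⟨x, t⟩ := q
        have : t = false := hQ (x, t) (by simp)
        subst this
        have e : (Q' ++ [(x, false)]) ++ (y, true) :: P = Q' ++ ((x, false) :: (y, true) :: P) := by
          simp
        rw [List.concat_eq_append] at *
        by_cases hxy : x = y
        · subst hxy
          have e2 : FreeGroup.mk ((Q' ++ [(x, false)]) ++ (x, true) :: P)
              = FreeGroup.mk (Q' ++ P) := by
            rw [e]
            exact Quot.sound (FreeGroup.Red.Step.not (x := x) (b := false))
          rw [e2] at hne hb
          exact ih Q' (fun a ha => hP a (by simp [ha])) (fun a ha => hQ a (by simp [ha])) hne b hb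
        · have hr : FreeGroup.IsReduced ((Q' ++ [(x, false)]) ++ (y, true) :: P) := by
            refine List.isChain_append.2 ⟨const_reduced false _ hQ, const_reduced true _ hP, ?_⟩
            intro a ha c hc hac
            simp at ha hc
            subst ha hc
            exact absurd hac hxy
          rw [e] at hr hb
          have : b = 0 := by simpa using hZ Q' x y P hr hb
          simp [this]
  intro g hg b hb
  have hr : FreeGroup.IsReduced g.toWord := FreeGroup.isReduced_toWord
  rw [← FreeGroup.mk_toWord (x := g)] at hb hg
  generalize g.toWord = L at hr hb hg
  rcases word_split L with ⟨P, Q, rfl, hP, hQ⟩ | ⟨L1, x, y, L2, rfl⟩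
  · refine hcat _ hker P Q hr ?_ hb
    intro a ha c hc
    change ψ (a * c) = 0
    rw [hKMS a _ c hc]
    have hca := hmul _ _ c hc a ha
    rw [FreeGroup.mul_mk] at hca
    rw [hQP P Q hP hQ ?_ _ hca, mul_zero]
    intro h1
    apply hg
    rw [← FreeGroup.mul_mk] at h1 ⊢
    exact mul_eq_one_comm.1 h1
  · have : b = 0 := by simpa using hZ L1 x y L2 hr hb
    simp [this]
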